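/- The ℤ²-graded algebra C_{5,2} has no bigraded system of parameters: there do not exist 26 bihomogeneous elements P₁, …, P₂₆ of C_{5,2} (26 being the Krull dimension of C_{5,2}) such that C_{5,2} is a finitely generated module over the subalgebra K[P₁, …, P₂₆] they generate. -/

import Mathlib

open MvPolynomial Matrix

noncomputable section

/-- Index type for the entries of a pair of generic `n × n` matrices:
`Sum.inl (i,j)` indexes the `(i,j)` entry of `x`, `Sum.inr (i,j)` that of `y`. -/
abbrev MatVar (n : ℕ) := (Fin n × Fin n) ⊕ (Fin n × Fin n)

/-- The substitution sending the variables to the entries of the pair `(A, B)`. -/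
def pairSub {K : Type*} [CommSemiring K] {n : ℕ} (A B : Matrix (Fin n) (Fin n) K) :
    MatVar n → K
  | Sum.inl ij => A ij.1 ij.2
  | Sum.inr ij => B ij.1 ij.2

/-- A polynomial function on pairs of `n × n` matrices is `GLₙ`-invariant (for the action
by simultaneous conjugation). -/
def IsMatInvariant {K : Type*} [Field K] {n : ℕ} (f : MvPolynomial (MatVar n) K) : Prop :=
  ∀ (a : GL (Fin n) K) (A B : Matrix (Fin n) (Fin n) K),
    MvPolynomial.eval
        (pairSub ((a : Matrix (Fin n) (Fin n) K) * A * ((a⁻¹ : GL (Fin n) K) : Matrix (Fin n) (Fin n) K))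
          ((a : Matrix (Fin n) (Fin n) K) * B * ((a⁻¹ : GL (Fin n) K) : Matrix (Fin n) (Fin n) K))) f =
      MvPolynomial.eval (pairSub A B) f

/-- The weight giving the bidegree: entries of `x` have weight `(1,0)`,
those of `y` have weight `(0,1)`. -/
def bideg (n : ℕ) : MatVar n → ℕ × ℕ
  | Sum.inl _ => (1, 0)
  | Sum.inr _ => (0, 1)

/-- The bigraded component of bidegree `(p, q)` of the pure trace algebra `C_{n,2}`. -/
def pureComponent (K : Type*) [Field K] (n p q : ℕ) : Set (MvPolynomial (MatVar n) K) :=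
  {f | IsMatInvariant f ∧ f.IsWeightedHomogeneous (bideg n) (p, q)}

/-- `dim_K C_{n,2}^{(p,q)}`. -/
def pureDim (K : Type*) [Field K] (n p q : ℕ) : ℕ :=
  Set.finrank K (pureComponent K n p q)

/-- The bigraded Poincaré series `P(C_{n,2}; s, t)`, with `s` the variable `X 0` and
`t` the variable `X 1`. -/
def purePS2 (K : Type*) [Field K] (n : ℕ) : MvPowerSeries (Fin 2) ℚ :=
  fun d => (pureDim K n (d 0) (d 1) : ℚ)

/-- abbreviation for the power series variable `s`. -/
def ps : MvPowerSeries (Fin 2) ℚ := MvPowerSeries.X 0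

/-- abbreviation for the power series variable `t`. -/
def pt : MvPowerSeries (Fin 2) ℚ := MvPowerSeries.X 1


/-- The pure trace algebra `C_{n,2}`: the subalgebra of `GLₙ`-invariant polynomial
functions on pairs of `n × n` matrices. -/
def pureAlg (K : Type*) [Field K] (n : ℕ) : Subalgebra K (MvPolynomial (MatVar n) K) where
  carrier := {f | IsMatInvariant f}
  mul_mem' := fun hf hg a A B => by
    simp only [_root_.map_mul]
    rw [hf a A B, hg a A B]
  add_mem' := fun hf hg a A B => by
    simp only [_root_.map_add]
    rw [hf a A B, hg a A B]
  algebraMap_mem' := fun c a A B => by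
    simp [MvPolynomial.algebraMap_eq]

/-- product of a word in two matrices -/
def wordMat {R : Type*} [CommRing R] (l : List Bool) (A B : Matrix (Fin 5) (Fin 5) R) :
    Matrix (Fin 5) (Fin 5) R :=
  (l.map (fun b => if b then A else B)).prod

theorem wordMat_map {R S : Type*} [CommRing R] [CommRing S] (f : R →+* S) (l : List Bool)
    (A B : Matrix (Fin 5) (Fin 5) R) :
    f.mapMatrix (wordMat l A B) = wordMat l (f.mapMatrix A) (f.mapMatrix B) := by
  unfold wordMat
  rw [map_list_prod, List.map_map]
  congr 2
  funext b
  cases b <;> rfl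

theorem wordMat_conj {K : Type*} [Field K] (a : GL (Fin 5) K) (l : List Bool)
    (A B : Matrix (Fin 5) (Fin 5) K) :
    wordMat l (a.val * A * (a⁻¹).val) (a.val * B * (a⁻¹).val) =
      a.val * wordMat l A B * (a⁻¹).val := by
  unfold wordMat
  induction l with
  | nil => simp
  | cons b l ih =>
    simp only [List.map_cons, List.prod_cons, ih]
    have h : (a⁻¹).val * a.val = 1 := by rw [← Units.val_mul]; simp
    have key : ∀ M N : Matrix (Fin 5) (Fin 5) K,
        a.val * M * (a⁻¹).val * (a.val * N * (a⁻¹).val) = a.val * (M * N) * (a⁻¹).val := by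
      intro M N
      calc _ = a.val * M * ((a⁻¹).val * a.val) * N * (a⁻¹).val := by
            simp only [Matrix.mul_assoc]
        _ = _ := by rw [h]; simp only [Matrix.mul_assoc, Matrix.one_mul]
    cases b
    · exact key _ _
    · exact key _ _

/-- generic matrices -/
def genX (K : Type*) [Field K] : Matrix (Fin 5) (Fin 5) (MvPolynomial (MatVar 5) K) :=
  Matrix.of fun i j => X (Sum.inl (i, j))
/-- generic matrices -/
def genY (K : Type*) [Field K] : Matrix (Fin 5) (Fin 5) (MvPolynomial (MatVar 5) K) :=
  Matrix.of fun i j => X (Sum.inr (i, j))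

theorem map_gen {K R : Type*} [Field K] [CommRing R] [Algebra K R]
    (A B : Matrix (Fin 5) (Fin 5) R) (l : List Bool) (n : ℕ) :
    aeval (pairSub A B) ((wordMat l (genX K) (genY K)).charpoly.coeff n) =
      (wordMat l A B).charpoly.coeff n := by
  have h1 := wordMat_map (aeval (R := K) (pairSub A B)).toRingHom l (genX K) (genY K)
  have hX : (aeval (R := K) (pairSub A B)).toRingHom.mapMatrix (genX K) = A := by
    ext i j; simp [genX, pairSub]
  have hY : (aeval (R := K) (pairSub A B)).toRingHom.mapMatrix (genY K) = B := by
    ext i j; simp [genY, pairSub]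
  rw [hX, hY] at h1
  rw [← h1]
  rw [RingHom.mapMatrix_apply, Matrix.charpoly_map, Polynomial.coeff_map]
  rfl

theorem mem_of_eval {K : Type*} [Field K] (l : List Bool) (n : ℕ)
    (g : MvPolynomial (MatVar 5) K)
    (h : ∀ A B : Matrix (Fin 5) (Fin 5) K,
      eval (pairSub A B) g = (wordMat l A B).charpoly.coeff n) : g ∈ pureAlg K 5 := by
  change IsMatInvariant g
  intro a A B
  rw [h, h, wordMat_conj]
  rw [Matrix.coe_units_inv, Matrix.charpoly_units_conj a]

theorem charpoly_mem {K : Type*} [Field K] (l : List Bool) (n : ℕ) :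
    (wordMat l (genX K) (genY K)).charpoly.coeff n ∈ pureAlg K 5 := by
  apply mem_of_eval l n
  intro A B
  rw [← map_gen (K := K) A B l n, MvPolynomial.aeval_eq_eval]

theorem integral_root {R A : Type*} [CommRing R] [CommRing A] [Algebra R A]
    (f : Polynomial A) (hf : f.Monic) (hc : ∀ n, IsIntegral R (f.coeff n)) (x : A)
    (hx : f.eval x = 0) : IsIntegral R x := by
  nontriviality A
  have hlift : f ∈ Polynomial.lifts (algebraMap (integralClosure R A) A) := by
    rw [Polynomial.lifts_iff_coeff_lifts]
    intro n
    exact ⟨⟨f.coeff n, hc n⟩, rfl⟩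
  obtain ⟨g, hg, -, hm⟩ := Polynomial.lifts_and_natDegree_eq_and_monic hlift hf
  have : IsIntegral (integralClosure R A) x := by
    refine ⟨g, hm, ?_⟩
    rw [Polynomial.eval₂_eq_eval_map, hg, hx]
  exact isIntegral_trans (R := R) (A := integralClosure R A) _ this

theorem weight_prod {K : Type*} [Field K] (c e : K) (d : MatVar 5 →₀ ℕ) :
    d.prod (fun v k => (Sum.elim (fun _ => c) (fun _ => e) v : K) ^ k) =
      c ^ (Finsupp.weight (bideg 5) d).1 * e ^ (Finsupp.weight (bideg 5) d).2 := by
  induction d using Finsupp.induction_linear with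
  | zero => simp
  | add f g hf hg =>
    rw [Finsupp.prod_add_index' (by simp) (by intros; rw [pow_add]), hf, hg, map_add]
    simp only [Prod.fst_add, Prod.snd_add, pow_add]
    ring
  | single v k =>
    rw [Finsupp.prod_single_index (by simp), Finsupp.weight_single]
    cases v <;> simp [bideg]

theorem eval_scale {K : Type*} [Field K] (c e : K) (f : MvPolynomial (MatVar 5) K) (a b : ℕ)
    (hf : f.IsWeightedHomogeneous (bideg 5) (a, b)) (x : MatVar 5 → K) :
    eval (fun v => (Sum.elim (fun _ => c) (fun _ => e) v : K) * x v) f =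
      c ^ a * e ^ b * eval x f := by
  rw [eval_eq, eval_eq, Finset.mul_sum]
  refine Finset.sum_congr rfl fun d hd => ?_
  have h := hf (mem_support_iff.mp hd)
  have h2 := weight_prod c e d
  rw [h] at h2
  simp only at h2
  rw [← h2]
  simp only [mul_pow, Finset.prod_mul_distrib, Finsupp.prod]
  ring

theorem const_of_zero {K : Type*} [Field K] [CharZero K] (f : MvPolynomial (MatVar 5) K)
    (hf : f.IsWeightedHomogeneous (bideg 5) (0, 0)) : f = C (eval 0 f) := by
  apply MvPolynomial.funext
  intro x
  have h := eval_scale 0 0 f 0 0 hf x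
  have h0 : (fun v => (Sum.elim (fun _ => (0:K)) (fun _ => 0) v : K) * x v) = 0 := by
    funext v; cases v <;> simp
  rw [h0] at h
  simpa using h.symm

theorem eval_vanish {K : Type*} [Field K] [CharZero K] (f : MvPolynomial (MatVar 5) K) (a b p q : ℕ)
    (hI : f ∈ pureAlg K 5)
    (hf : f.IsWeightedHomogeneous (bideg 5) (a, b)) (hab : a * q ≠ b * p)
    (A B : Matrix (Fin 5) (Fin 5) K)
    (hA : ∀ i j : Fin 5, A i j ≠ 0 → (i : ℕ) = j + q)
    (hB : ∀ i j : Fin 5, B i j ≠ 0 → (i : ℕ) + p = j) :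
    eval (pairSub A B) f = 0 := by
  let D : GL (Fin 5) K :=
    ⟨Matrix.diagonal fun i => (2:K) ^ (i : ℕ), Matrix.diagonal fun i => ((2:K) ^ (i : ℕ))⁻¹,
      by rw [Matrix.diagonal_mul_diagonal]; simp,
      by rw [Matrix.diagonal_mul_diagonal]; simp⟩
  have h := hI D A B
  have h1 := eval_scale (2 ^ q) ((2 ^ p)⁻¹) f a b hf (pairSub A B)
  have h2 : (fun v => (Sum.elim (fun _ => (2:K) ^ q) (fun _ => (2 ^ p)⁻¹) v : K) * pairSub A B v) =
      pairSub (D.val * A * (D⁻¹).val) (D.val * B * (D⁻¹).val) := by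
    have hd : D.val = Matrix.diagonal fun i : Fin 5 => (2:K) ^ (i : ℕ) := rfl
    have hd' : (D⁻¹).val = Matrix.diagonal fun i : Fin 5 => ((2:K) ^ (i : ℕ))⁻¹ := rfl
    rw [hd, hd']
    funext v
    rcases v with ⟨i, j⟩ | ⟨i, j⟩
    · simp only [pairSub, Sum.elim_inl, Matrix.mul_diagonal, Matrix.diagonal_mul]
      by_cases h0 : A i j = 0
      · simp [h0]
      · rw [hA i j h0]; field_simp; ring
    · simp only [pairSub, Sum.elim_inr, Matrix.mul_diagonal, Matrix.diagonal_mul]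
      by_cases h0 : B i j = 0
      · simp [h0]
      · rw [← hB i j h0]; field_simp; ring
  rw [h2, h] at h1
  by_contra hne
  have h3 : (2 ^ q : K) ^ a * ((2 ^ p)⁻¹) ^ b = 1 := by
    have : (1 - (2 ^ q : K) ^ a * ((2 ^ p)⁻¹) ^ b) * eval (pairSub A B) f = 0 := by
      linear_combination h1
    rcases mul_eq_zero.mp this with h | h
    · linear_combination -h
    · exact absurd h hne
  rw [inv_pow, ← div_eq_mul_inv, div_eq_one_iff_eq (pow_ne_zero _ (pow_ne_zero _ two_ne_zero)), ← pow_mul, ← pow_mul] at h3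
  have h4 : (2:ℕ) ^ (q * a) = 2 ^ (p * b) := by exact_mod_cast h3
  have h5 := Nat.pow_right_injective (le_refl 2) h4
  apply hab
  rw [mul_comm a, mul_comm b]; exact h5

theorem aeval_vanish {K : Type*} [Field K] [CharZero K] {d : ℕ}
    (f : MvPolynomial (MatVar 5) K) (a b p q : ℕ)
    (hI : f ∈ pureAlg K 5)
    (hf : f.IsWeightedHomogeneous (bideg 5) (a, b)) (hab : a * q ≠ b * p)
    (A B : Matrix (Fin 5) (Fin 5) (MvPolynomial (Fin d) K))
    (hA : ∀ i j : Fin 5, A i j ≠ 0 → (i : ℕ) = j + q)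
    (hB : ∀ i j : Fin 5, B i j ≠ 0 → (i : ℕ) + p = j) :
    aeval (pairSub A B) f = 0 := by
  apply MvPolynomial.funext
  intro t
  have h := eval_vanish f a b p q hI hf hab ((eval t).mapMatrix A) ((eval t).mapMatrix B)
    (fun i j h => hA i j (by intro h0; apply h; simp [h0]))
    (fun i j h => hB i j (by intro h0; apply h; simp [h0]))
  rw [map_zero, ← h, MvPolynomial.aeval_def, ← MvPolynomial.coe_eval₂Hom, ← RingHom.comp_apply]
  congr 1
  apply MvPolynomial.ringHom_ext
  · intro r; simp
  · intro v; rcases v with ⟨i, j⟩ | ⟨i, j⟩ <;> simp [pairSub]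

theorem integral_C {K : Type*} [Field K] (P : Fin 26 → MvPolynomial (MatVar 5) K)
    (hP : ∀ i, P i ∈ pureAlg K 5) (m : ℕ) (Q : Fin m → MvPolynomial (MatVar 5) K)
    (hQ : ∀ j, Q j ∈ pureAlg K 5)
    (h : ∀ f ∈ pureAlg K 5, ∃ c : Fin m → MvPolynomial (MatVar 5) K,
            (∀ j, c j ∈ Algebra.adjoin K (Set.range P)) ∧ f = ∑ j, c j * Q j)
    (f : MvPolynomial (MatVar 5) K) (hf : f ∈ pureAlg K 5) :
    IsIntegral (Algebra.adjoin K (Set.range P)) f := by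
  have hle : Algebra.adjoin K (Set.range P) ≤ pureAlg K 5 := by
    apply Algebra.adjoin_le
    rintro _ ⟨i, rfl⟩
    exact hP i
  let S : Subalgebra (Algebra.adjoin K (Set.range P)) (MvPolynomial (MatVar 5) K) :=
    { carrier := pureAlg K 5
      mul_mem' := fun ha hb => (pureAlg K 5).mul_mem ha hb
      add_mem' := fun ha hb => (pureAlg K 5).add_mem ha hb
      algebraMap_mem' := fun r => hle r.2 }
  refine IsIntegral.of_mem_of_fg S ?_ f hf
  have : Subalgebra.toSubmodule S = Submodule.span _ (Set.range Q) := by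
    apply le_antisymm
    · intro g hg
      obtain ⟨c, hc, rfl⟩ := h g hg
      refine Submodule.sum_mem _ fun j _ => ?_
      exact Submodule.smul_mem _ (⟨c j, hc j⟩ : Algebra.adjoin K (Set.range P))
        (Submodule.subset_span ⟨j, rfl⟩)
    · rw [Submodule.span_le]
      rintro _ ⟨j, rfl⟩
      exact hQ j
  rw [this]
  exact Submodule.fg_span (Set.finite_range Q)

theorem direction {K : Type*} [Field K] [CharZero K] (P : Fin 26 → MvPolynomial (MatVar 5) K)
    (hP : ∀ i, P i ∈ pureAlg K 5) (a b : Fin 26 → ℕ)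
    (hab : ∀ i, (P i).IsWeightedHomogeneous (bideg 5) (a i, b i))
    (hint : ∀ f ∈ pureAlg K 5, IsIntegral (Algebra.adjoin K (Set.range P)) f)
    (p q d : ℕ) (A B : Matrix (Fin 5) (Fin 5) (MvPolynomial (Fin d) K))
    (hA : ∀ i j : Fin 5, A i j ≠ 0 → (i : ℕ) = j + q)
    (hB : ∀ i j : Fin 5, B i j ≠ 0 → (i : ℕ) + p = j)
    (l : List Bool)
    (hw : ∀ k : Fin d, ∃ i : Fin 5, wordMat l A B *ᵥ Pi.single i 1 = (X k : MvPolynomial (Fin d) K) • Pi.single i 1) :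
    d ≤ (Finset.univ.filter fun i => a i * q = b i * p ∧ (a i, b i) ≠ (0, 0)).card := by
  classical
  set N := Finset.univ.filter fun i => a i * q = b i * p ∧ (a i, b i) ≠ (0, 0) with hN
  let φ : MvPolynomial (MatVar 5) K →ₐ[K] MvPolynomial (Fin d) K := aeval (pairSub A B)
  let s : Finset (MvPolynomial (Fin d) K) := N.image fun i => φ (P i)
  let T := Algebra.adjoin K (s : Set (MvPolynomial (Fin d) K))
  have hPT : ∀ i, φ (P i) ∈ T := by
    intro i
    by_cases h1 : a i * q = b i * p
    · by_cases h2 : (a i, b i) = (0, 0)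
      · have h3 := hab i
        rw [h2] at h3
        rw [const_of_zero _ h3]
        change aeval _ (C _) ∈ T
        rw [aeval_C]
        exact T.algebraMap_mem _
      · apply Algebra.subset_adjoin
        simp only [s, Finset.coe_image]
        exact ⟨i, by simpa [hN, h1] using h2, rfl⟩
    · have : φ (P i) = 0 := aeval_vanish (P i) _ _ p q (hP i) (hab i) h1 A B hA hB
      rw [this]; exact T.zero_mem
  have hST : ∀ g ∈ Algebra.adjoin K (Set.range P), φ g ∈ T := by
    have : Algebra.adjoin K (Set.range P) ≤ T.comap φ := by
      apply Algebra.adjoin_le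
      rintro _ ⟨i, rfl⟩
      exact hPT i
    exact this
  let ψ : Algebra.adjoin K (Set.range P) →+* T :=
    ((φ.comp (Algebra.adjoin K (Set.range P)).val).codRestrict T (fun x => hST _ x.2)).toRingHom
  have hint2 : ∀ f ∈ pureAlg K 5, IsIntegral T (φ f) := by
    intro f hf
    exact (hint f hf).map_of_comp_eq ψ φ.toRingHom (by ext x <;> rfl)
  have hX : ∀ k : Fin d, IsIntegral T (X k : MvPolynomial (Fin d) K) := by
    intro k
    obtain ⟨i, hi⟩ := hw k
    have hroot : (wordMat l A B).charpoly.eval (X k : MvPolynomial (Fin d) K) = 0 := by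
      rw [Matrix.eval_charpoly, ← Matrix.exists_mulVec_eq_zero_iff]
      refine ⟨Pi.single i 1, ?_, ?_⟩
      · intro h
        have := congrFun h i
        simp at this
      · rw [Matrix.sub_mulVec, hi]
        ext1 j
        rcases eq_or_ne j i with rfl | hji
        · simp [Matrix.scalar_apply]
        · simp [Matrix.scalar_apply, hji]
    refine integral_root _ (Matrix.charpoly_monic (wordMat l A B)) (fun n => ?_) _ hroot
    rw [← map_gen (K := K)]
    exact hint2 _ (charpoly_mem l n)
  have hall : ∀ f : MvPolynomial (Fin d) K, IsIntegral T f := by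
    intro f
    induction f using MvPolynomial.induction_on with
    | C r =>
      exact isIntegral_algebraMap (R := T) (x := algebraMap K T r)
    | add f g hf hg => exact hf.add hg
    | mul_X f k hf => exact hf.mul (hX k)
  have : Algebra.IsAlgebraic (Algebra.adjoin K (s : Set (MvPolynomial (Fin d) K))) (MvPolynomial (Fin d) K) :=
    ⟨fun f => (hall f).isAlgebraic⟩
  have htr := Algebra.IsAlgebraic.trdeg_le_cardinalMk (R := K) (A := MvPolynomial (Fin d) K) (s : Set (MvPolynomial (Fin d) K))
  rw [MvPolynomial.trdeg_of_isDomain] at htr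
  have h1 : d ≤ s.card := by
    simpa using htr
  exact h1.trans Finset.card_image_le

theorem mulA {R : Type*} [CommRing R] (α : Fin 5 → R) (q : ℕ) (i j : Fin 5) (c : R)
    (h : (i : ℕ) = j + q) :
    (Matrix.of fun i j : Fin 5 => if (i : ℕ) = j + q then α j else 0) *ᵥ Pi.single j c =
      Pi.single i (α j * c) := by
  rw [Matrix.mulVec_single]
  ext1 k
  rcases eq_or_ne k i with rfl | hk
  · simp [h]
  · have : (k : ℕ) ≠ j + q := fun h' => hk (Fin.ext (h'.trans h.symm))
    simp [hk, this]

theorem mulB {R : Type*} [CommRing R] (β : Fin 5 → R) (p : ℕ) (i j : Fin 5) (c : R)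
    (h : (i : ℕ) + p = j) :
    (Matrix.of fun i j : Fin 5 => if (i : ℕ) + p = j then β i else 0) *ᵥ Pi.single j c =
      Pi.single i (β i * c) := by
  rw [Matrix.mulVec_single]
  ext1 k
  rcases eq_or_ne k i with rfl | hk
  · simp [h]
  · have : (k : ℕ) + p ≠ j := fun h' => hk (Fin.ext (by omega))
    simp [hk, this]

theorem wordMat_true {R : Type*} [CommRing R] (l : List Bool) (A B : Matrix (Fin 5) (Fin 5) R)
    (v : Fin 5 → R) : wordMat (true :: l) A B *ᵥ v = A *ᵥ (wordMat l A B *ᵥ v) := by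
  rw [Matrix.mulVec_mulVec]; rfl

theorem wordMat_false {R : Type*} [CommRing R] (l : List Bool) (A B : Matrix (Fin 5) (Fin 5) R)
    (v : Fin 5 → R) : wordMat (false :: l) A B *ᵥ v = B *ᵥ (wordMat l A B *ᵥ v) := by
  rw [Matrix.mulVec_mulVec]; rfl

theorem wordMat_nil {R : Type*} [CommRing R] (A B : Matrix (Fin 5) (Fin 5) R)
    (v : Fin 5 → R) : wordMat [] A B *ᵥ v = v := by
  simp [wordMat]

theorem shiftA {R : Type*} [CommRing R] (B : Matrix (Fin 5) (Fin 5) R) (p : ℕ) :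
    ∀ (i j : Fin 5) (c : R), (i : ℕ) = j + p →
    wordMat (List.replicate p true)
      (Matrix.of fun i j : Fin 5 => if (i : ℕ) = j + 1 then (fun _ => (1 : R)) j else 0) B *ᵥ
        Pi.single j c = Pi.single i c := by
  induction p with
  | zero =>
    intro i j c h
    have : i = j := Fin.ext h
    rw [this]; exact wordMat_nil _ _ _
  | succ p ih =>
    intro i j c h
    rw [List.replicate_succ, wordMat_true, ih ⟨j + p, by omega⟩ j c rfl, mulA _ 1 i _ _ h, one_mul]

theorem shiftB {R : Type*} [CommRing R] (A : Matrix (Fin 5) (Fin 5) R) (q : ℕ) (i j : Fin 5)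
    (v : Fin 5 → R) (l : List Bool) (c : R) (h : (i : ℕ) + q = j)
    (hl : wordMat l A
      (Matrix.of fun i j : Fin 5 => if (i : ℕ) + 1 = j then (fun _ => (1 : R)) i else 0) *ᵥ v =
        Pi.single j c) :
    wordMat (List.replicate q false ++ l) A
      (Matrix.of fun i j : Fin 5 => if (i : ℕ) + 1 = j then (fun _ => (1 : R)) i else 0) *ᵥ v =
        Pi.single i c := by
  induction q generalizing i with
  | zero =>
    have : i = j := Fin.ext h
    rw [this]; exact hl
  | succ q ih =>
    rw [List.replicate_succ, List.cons_append, wordMat_false, ih ⟨i + 1, by omega⟩ (by simp; omega),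
      mulB _ _ i _ _ rfl, one_mul]


theorem exists_family (K : Type*) [Field K] (p q : ℕ)
    (h : (p, q) ∈ ((Finset.range 6 ×ˢ Finset.range 6).filter
      fun z => Nat.Coprime z.1 z.2 ∧ z.1 + z.2 ≤ 5)) :
    ∃ (A B : Matrix (Fin 5) (Fin 5) (MvPolynomial (Fin (6 - p - q)) K)) (l : List Bool),
    (∀ i j : Fin 5, A i j ≠ 0 → (i : ℕ) = j + q) ∧
    (∀ i j : Fin 5, B i j ≠ 0 → (i : ℕ) + p = j) ∧
    (∀ k : Fin (6 - p - q), ∃ i : Fin 5, wordMat l A B *ᵥ Pi.single i 1 =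
      (X k : MvPolynomial (Fin (6 - p - q)) K) • Pi.single i 1) := by
  suffices H : ∃ (α β : Fin 5 → MvPolynomial (Fin (6 - p - q)) K) (l : List Bool),
      ∀ k : Fin (6 - p - q), ∃ i : Fin 5,
      wordMat l (Matrix.of fun i j : Fin 5 => if (i : ℕ) = j + q then α j else 0)
        (Matrix.of fun i j : Fin 5 => if (i : ℕ) + p = j then β i else 0) *ᵥ Pi.single i 1 =
      (X k : MvPolynomial (Fin (6 - p - q)) K) • Pi.single i 1 by
    obtain ⟨α, β, l, hl⟩ := H
    refine ⟨_, _, l, ?_, ?_, hl⟩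
    · intro i j h
      by_contra h2
      simp [h2] at h
    · intro i j h
      by_contra h2
      simp [h2] at h
  have hcases : (q = 1 ∧ p ≤ 4) ∨ (p = 1 ∧ q ≤ 4) ∨ (p = 3 ∧ q = 2) ∨ (p = 2 ∧ q = 3) := by
    revert h
    simp only [Finset.mem_filter, Finset.mem_product, Finset.mem_range]
    rintro ⟨⟨h1, h2⟩, h3, h4⟩
    interval_cases p <;> interval_cases q <;> revert h3 h4 <;> decide
  rcases hcases with ⟨rfl, hp⟩ | ⟨rfl, hq⟩ | ⟨rfl, rfl⟩ | ⟨rfl, rfl⟩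
  · refine ⟨fun _ => 1, fun i => if h : (i : ℕ) < 6 - p - 1 then X ⟨i, h⟩ else 0,
      false :: List.replicate p true, fun k => ⟨⟨k, by omega⟩, ?_⟩⟩
    rw [wordMat_false, shiftA _ p ⟨k + p, by omega⟩ _ _ rfl, mulB _ _ ⟨k, by omega⟩ _ _ rfl,
      ← Pi.single_smul]
    simp
  · refine ⟨fun i => if h : (i : ℕ) < 6 - 1 - q then X ⟨i, h⟩ else 0, fun _ => 1,
      List.replicate q false ++ [true], fun k => ⟨⟨k, by omega⟩, ?_⟩⟩
    rw [← Pi.single_smul]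
    refine shiftB _ q _ ⟨k + q, by omega⟩ _ _ _ rfl ?_
    rw [wordMat_true, wordMat_nil, mulA _ _ ⟨k + q, by omega⟩ _ _ rfl]
    simp
  · refine ⟨fun _ => 1, fun i => if i = 0 then X 0 else 1,
      [false, true, false, true, true], fun k => ⟨0, ?_⟩⟩
    have hk : k = 0 := by fin_cases k; rfl
    rw [wordMat_false, wordMat_true, wordMat_false, wordMat_true, wordMat_true, wordMat_nil,
      mulA _ _ 2 _ _ rfl, mulA _ _ 4 _ _ rfl, mulB _ _ 1 _ _ rfl, mulA _ _ 3 _ _ rfl,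
      mulB _ _ 0 _ _ rfl, ← Pi.single_smul, hk]
    simp
  · refine ⟨fun i => if i = 0 then X 0 else 1, fun _ => 1,
      [false, false, true, false, true], fun k => ⟨0, ?_⟩⟩
    have hk : k = 0 := by fin_cases k; rfl
    rw [wordMat_false, wordMat_false, wordMat_true, wordMat_false, wordMat_true, wordMat_nil,
      mulA _ _ 3 _ _ rfl, mulB _ _ 1 _ _ rfl, mulA _ _ 4 _ _ rfl, mulB _ _ 2 _ _ rfl,
      mulB _ _ 0 _ _ rfl, ← Pi.single_smul, hk]
    simp

theorem no_bigraded_hsop_C52 (K : Type*) [Field K] [CharZero K] :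
    ¬ ∃ P : Fin 26 → MvPolynomial (MatVar 5) K,
        (∀ i, P i ∈ pureAlg K 5) ∧
        (∀ i, ∃ p q : ℕ, (P i).IsWeightedHomogeneous (bideg 5) (p, q)) ∧
        ∃ (m : ℕ) (Q : Fin m → MvPolynomial (MatVar 5) K),
          (∀ j, Q j ∈ pureAlg K 5) ∧
          ∀ f ∈ pureAlg K 5, ∃ c : Fin m → MvPolynomial (MatVar 5) K,
            (∀ j, c j ∈ Algebra.adjoin K (Set.range P)) ∧ f = ∑ j, c j * Q j := by
  rintro ⟨P, hP, hab, m, Q, hQ, h⟩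
  choose a b hab using hab
  have hint := integral_C P hP m Q hQ h
  have hdir : ∀ z ∈ ((Finset.range 6 ×ˢ Finset.range 6).filter
      fun z : ℕ × ℕ => Nat.Coprime z.1 z.2 ∧ z.1 + z.2 ≤ 5), 6 - z.1 - z.2 ≤
      (Finset.univ.filter fun i => a i * z.2 = b i * z.1 ∧ (a i, b i) ≠ (0, 0)).card := by
    rintro ⟨p, q⟩ hz
    obtain ⟨A, B, l, hA, hB, hw⟩ := exists_family K p q hz
    exact direction P hP a b hab hint p q _ A B hA hB l hw
  have hsum := Finset.sum_le_sum hdir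
  rw [← Finset.card_biUnion] at hsum
  · have h1 := hsum.trans (Finset.card_le_univ _)
    revert h1
    rw [Fintype.card_fin]
    decide
  · intro z hz w hw hne
    rw [Function.onFun, Finset.disjoint_left]
    intro i hi hi'
    simp only [Finset.mem_filter, Finset.mem_univ, true_and] at hi hi'
    obtain ⟨h1, h2⟩ := hi
    obtain ⟨h3, -⟩ := hi'
    have hx : z.1 * w.2 = w.1 * z.2 := by
      by_cases ha : a i = 0
      · have hb : b i ≠ 0 := by
          intro hb; exact h2 (by rw [ha, hb])
        rw [ha, zero_mul] at h1 h3
        have hz1 : z.1 = 0 := by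
          rcases Nat.mul_eq_zero.mp h1.symm with h | h
          · exact absurd h hb
          · exact h
        have hw1 : w.1 = 0 := by
          rcases Nat.mul_eq_zero.mp h3.symm with h | h
          · exact absurd h hb
          · exact h
        rw [hz1, hw1]; simp
      · apply Nat.eq_of_mul_eq_mul_left (Nat.pos_of_ne_zero ha)
        calc a i * (z.1 * w.2) = z.1 * (a i * w.2) := by ring
          _ = w.1 * (b i * z.1) := by rw [h3]; ring
          _ = _ := by rw [← h1]; ring
    have hdec : ∀ z ∈ ((Finset.range 6 ×ˢ Finset.range 6).filter
      fun z : ℕ × ℕ => Nat.Coprime z.1 z.2 ∧ z.1 + z.2 ≤ 5), ∀ w ∈ ((Finset.range 6 ×ˢ Finset.range 6).filter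
      fun z : ℕ × ℕ => Nat.Coprime z.1 z.2 ∧ z.1 + z.2 ≤ 5), z.1 * w.2 = w.1 * z.2 → z = w := by
      decide
    exact hne (hdec z (Finset.mem_coe.mp hz) w (Finset.mem_coe.mp hw) hx)
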